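/- Let Ĝ^2 be a swap-maximal loopy graph whose largest clique K^0 contained in V^0 has exactly 2 vertices, and suppose that every vertex of V^0 has degree at most that of every vertex not in V^0. Then Ĝ^2 is m*-loopy: it has self-loops exactly at the m* highest-degree vertices. -/

import Mathlib

open scoped Classical

/-- A loopy graph: at most one edge between any two distinct vertices and at most one
self-loop at each vertex, encoded as a symmetric adjacency relation. -/
structure LoopyGraph (V : Type) where
  Adj : V → V → Prop
  symm : ∀ u v : V, Adj u v → Adj v u

namespace LoopyGraph

variable {V : Type}

/-- The neighbors of `u` (vertices other than `u` adjacent to `u`). -/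
def nbr (G : LoopyGraph V) (u : V) : Set V := {v | v ≠ u ∧ G.Adj u v}

/-- Degree of a vertex: each self-loop contributes `2`. -/
noncomputable def deg (G : LoopyGraph V) (u : V) : ℕ :=
  (G.nbr u).ncard + (if G.Adj u u then 2 else 0)

/-- `G₂` is obtained from `G₁` by a single valid double edge swap
`(u,v),(x,y) ⤳ (u,x),(v,y)`: the two removed edges are distinct edges of `G₁`, the two
added edges are distinct and not already present (no multiedge and no doubled
self-loop is created). -/
def DoubleEdgeSwap (G₁ G₂ : LoopyGraph V) : Prop :=
  ∃ u v x y : V,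
    G₁.Adj u v ∧ G₁.Adj x y ∧
    s(u, v) ≠ s(x, y) ∧
    ¬ G₁.Adj u x ∧ ¬ G₁.Adj v y ∧ s(u, x) ≠ s(v, y) ∧
    ∀ a b : V, G₂.Adj a b ↔
      ((G₁.Adj a b ∧ s(a, b) ≠ s(u, v) ∧ s(a, b) ≠ s(x, y)) ∨
        s(a, b) = s(u, x) ∨ s(a, b) = s(v, y))

/-- `G₂` is reachable from `G₁` by a finite sequence of valid double edge swaps. -/
def Reach (G₁ G₂ : LoopyGraph V) : Prop :=
  Relation.ReflTransGen DoubleEdgeSwap G₁ G₂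

/-- Vertices at (shortest-path) distance at most `k` from the set of loop-free vertices. -/
def within (G : LoopyGraph V) : ℕ → Set V
  | 0 => {v | ¬ G.Adj v v}
  | (k + 1) => within G k ∪ {v | ∃ u ∈ within G k, G.Adj v u}

/-- `Vset G 0 = V^0` is the set of vertices with no self-loop; for `k ≥ 1`,
`Vset G k = V^k` is the set of vertices (necessarily carrying a self-loop) whose
shortest-path distance to `V^0` is exactly `k`. -/
def Vset (G : LoopyGraph V) : ℕ → Set V
  | 0 => {v | ¬ G.Adj v v}
  | (k + 1) => within G (k + 1) \ within G k

/-- `V^∞`: vertices (with a self-loop) having no path to `V^0`. -/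
def Vinf (G : LoopyGraph V) : Set V := {v | ∀ k : ℕ, v ∉ within G k}

/-- A set of vertices is a clique when all pairs of distinct members are adjacent. -/
def IsClique (G : LoopyGraph V) (s : Set V) : Prop :=
  ∀ x ∈ s, ∀ y ∈ s, x ≠ y → G.Adj x y

/-- The set of vertices carrying a self-loop. -/
def selfLoops (G : LoopyGraph V) : Set V := {v | G.Adj v v}

/-- The edges of `G` with both endpoints in `V^0`. -/
def V0edges (G : LoopyGraph V) : Set (Sym2 V) :=
  {e | ∃ u v : V, e = s(u, v) ∧ G.Adj u v ∧ u ∈ Vset G 0 ∧ v ∈ Vset G 0}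

/-- `Ĝ` is swap-maximal: among all loopy graphs reachable from it by double edge swaps it
has the maximum number of self-loops, and subject to that the maximum number of edges with
both endpoints in `V^0`. -/
def SwapMaximal (G : LoopyGraph V) : Prop :=
  ∀ H : LoopyGraph V, Reach G H →
    (selfLoops H).ncard ≤ (selfLoops G).ncard ∧
      ((selfLoops H).ncard = (selfLoops G).ncard →
        (V0edges H).ncard ≤ (V0edges G).ncard)

/-- `K` is a largest clique contained in `V^0`, and it has exactly `d` vertices. -/
def LargestV0Clique (G : LoopyGraph V) (K : Set V) (d : ℕ) : Prop :=
  K ⊆ Vset G 0 ∧ IsClique G K ∧ K.ncard = d ∧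
    ∀ K' : Set V, K' ⊆ Vset G 0 → IsClique G K' → K'.ncard ≤ d

/-- Class `Q1`. -/
def Q1 (G : LoopyGraph V) : Prop :=
  ∃ K : Set V, K ⊆ Vset G 0 ∧ 4 ≤ K.ncard ∧ IsClique G K ∧
    (∀ u ∈ Vset G 0, (∀ w ∈ Vset G 0, ¬ G.Adj u w) ∨ u ∈ K) ∧
    IsClique G (Vset G 1 ∪ K) ∧
    Vset G 2 = ∅ ∧ Vinf G = ∅

/-- Class `Q2`. -/
def Q2 (G : LoopyGraph V) : Prop :=
  3 ≤ {u | u ∈ Vset G 0 ∧ (nbr G u ∩ Vset G 0).ncard = 2}.ncard ∧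
  (∀ u ∈ Vset G 0,
      (∀ w ∈ Vset G 0, ¬ G.Adj u w) ∨
        ((nbr G u ∩ Vset G 0).ncard = 2 ∧ ∀ w ∈ Vset G 1, G.Adj u w)) ∧
  IsClique G (Vset G 1) ∧
  (∀ u ∈ Vset G 2, nbr G u = Vset G 1) ∧
  Vset G 3 = ∅ ∧
  (Vinf G = ∅ ∨ (Vset G 1 = ∅ ∧ ∀ u ∈ Vinf G, deg G u = 2))

/-- The graph of loopy graphs `𝒢({k_i})` is connected: any two loopy graphs with degree
sequence `k` are linked by a finite sequence of valid double edge swaps. -/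
def GConnected (k : V → ℕ) : Prop :=
  ∀ G₁ G₂ : LoopyGraph V, (∀ v, deg G₁ v = k v) → (∀ v, deg G₂ v = k v) →
    Reach G₁ G₂

/-- `G₂` is obtained from `G₁` by a single valid triangle-loop swap: either a triangle on
three distinct vertices is replaced by three self-loops, or conversely. -/
def TriangleLoopSwap (G₁ G₂ : LoopyGraph V) : Prop :=
  ∃ u v w : V, u ≠ v ∧ v ≠ w ∧ u ≠ w ∧
    ((G₁.Adj u v ∧ G₁.Adj v w ∧ G₁.Adj w u ∧
        ¬ G₁.Adj u u ∧ ¬ G₁.Adj v v ∧ ¬ G₁.Adj w w ∧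
        ∀ a b : V, G₂.Adj a b ↔
          ((G₁.Adj a b ∧ s(a, b) ≠ s(u, v) ∧ s(a, b) ≠ s(v, w) ∧ s(a, b) ≠ s(w, u)) ∨
            s(a, b) = s(u, u) ∨ s(a, b) = s(v, v) ∨ s(a, b) = s(w, w))) ∨
      (G₁.Adj u u ∧ G₁.Adj v v ∧ G₁.Adj w w ∧
        ¬ G₁.Adj u v ∧ ¬ G₁.Adj v w ∧ ¬ G₁.Adj w u ∧
        ∀ a b : V, G₂.Adj a b ↔
          ((G₁.Adj a b ∧ s(a, b) ≠ s(u, u) ∧ s(a, b) ≠ s(v, v) ∧ s(a, b) ≠ s(w, w)) ∨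
            s(a, b) = s(u, v) ∨ s(a, b) = s(v, w) ∨ s(a, b) = s(w, u))))

/-- Reachability in the augmented graph of loopy graphs `𝒢_△`: a finite sequence of moves,
each a valid double edge swap or a valid triangle-loop swap. -/
def ReachTri (G₁ G₂ : LoopyGraph V) : Prop :=
  Relation.ReflTransGen
    (fun H₁ H₂ => DoubleEdgeSwap H₁ H₂ ∨ TriangleLoopSwap H₁ H₂) G₁ G₂

/-- `S` is a set of highest-degree vertices for the degree sequence `k`. -/
def TopSet (k : V → ℕ) (S : Set V) : Prop :=
  ∀ u ∈ S, ∀ v : V, v ∉ S → k v ≤ k u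

/-- A loopy graph is simple when it has no self-loops. -/
def IsSimple (G : LoopyGraph V) : Prop := ∀ v : V, ¬ G.Adj v v

/-- `k` is the degree sequence of some simple graph. -/
def SimpleGraphical (k : V → ℕ) : Prop :=
  ∃ G : LoopyGraph V, IsSimple G ∧ ∀ v, deg G v = k v

/-- `k` is `m`-simple-graphical: subtracting `2` from each of the `m` largest entries
yields a simple-graphical sequence. -/
def MSimpleGraphical (k : V → ℕ) (m : ℕ) : Prop :=
  ∃ S : Set V, S.ncard = m ∧ TopSet k S ∧ (∀ v ∈ S, 2 ≤ k v) ∧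
    SimpleGraphical (fun v : V => if v ∈ S then k v - 2 else k v)

/-- `m` is `m*`, the maximum `m` for which the sequence is `m`-simple-graphical. -/
def IsMStar (k : V → ℕ) (m : ℕ) : Prop :=
  MSimpleGraphical k m ∧ ∀ m' : ℕ, MSimpleGraphical k m' → m' ≤ m

/-- `G` is `m`-loopy: it has self-loops exactly at `m` highest-degree vertices. -/
def MLoopy (G : LoopyGraph V) (m : ℕ) : Prop :=
  (selfLoops G).ncard = m ∧ TopSet (deg G) (selfLoops G)

end LoopyGraph

namespace LoopyGraph

variable {V : Type}

/-- The graph obtained from `G` by replacing the edges `(u,v)`, `(x,y)` by `(u,x)`, `(v,y)`. -/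
def swap (G : LoopyGraph V) (u v x y : V) : LoopyGraph V where
  Adj a b := (G.Adj a b ∧ s(a, b) ≠ s(u, v) ∧ s(a, b) ≠ s(x, y)) ∨
    s(a, b) = s(u, x) ∨ s(a, b) = s(v, y)
  symm a b h := by
    rw [Sym2.eq_swap (a := b) (b := a)]
    exact h.imp (fun h => ⟨G.symm _ _ h.1, h.2⟩) id

theorem adj_comm (G : LoopyGraph V) (u v : V) : G.Adj u v ↔ G.Adj v u :=
  ⟨G.symm u v, G.symm v u⟩

theorem swap_adj (G : LoopyGraph V) (u v x y a b : V) :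
    (G.swap u v x y).Adj a b ↔
      (G.Adj a b ∧ s(a, b) ≠ s(u, v) ∧ s(a, b) ≠ s(x, y)) ∨
        s(a, b) = s(u, x) ∨ s(a, b) = s(v, y) :=
  Iff.rfl

theorem doubleEdgeSwap_swap {G : LoopyGraph V} {u v x y : V} (huv : G.Adj u v)
    (hxy : G.Adj x y) (hne : s(u, v) ≠ s(x, y)) (hux : ¬ G.Adj u x) (hvy : ¬ G.Adj v y)
    (hne' : s(u, x) ≠ s(v, y)) : DoubleEdgeSwap G (G.swap u v x y) :=
  ⟨u, v, x, y, huv, hxy, hne, hux, hvy, hne', fun _ _ => Iff.rfl⟩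

/-- No graph reachable from `G` has more self-loops than `G`. -/
def LoopMaximal (G : LoopyGraph V) : Prop :=
  ∀ H : LoopyGraph V, Reach G H → (selfLoops H).ncard ≤ (selfLoops G).ncard

/-- A double edge swap involving no self-loop preserves loop-maximality. -/
theorem LoopMaximal.swap {G : LoopyGraph V} (hG : G.LoopMaximal) {u v x y : V}
    (huv : G.Adj u v) (hxy : G.Adj x y) (hne : s(u, v) ≠ s(x, y)) (hux : ¬ G.Adj u x)
    (hvy : ¬ G.Adj v y) (hne' : s(u, x) ≠ s(v, y)) (h1 : u ≠ v) (h2 : x ≠ y) (h3 : u ≠ x)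
    (h4 : v ≠ y) : (G.swap u v x y).LoopMaximal := by
  have hloops : selfLoops (G.swap u v x y) = selfLoops G := by
    ext a
    simp only [selfLoops, Set.mem_ofPred_eq, swap_adj, Sym2.eq_iff, ne_eq]
    grind
  intro H hH
  rw [hloops]
  exact hG H (hH.head (doubleEdgeSwap_swap huv hxy hne hux hvy hne'))

/-- In a loop-maximal graph, the neighborhood of a loop-free vertex is a clique. -/
theorem LoopMaximal.adj_of_adj [Finite V] {G : LoopyGraph V} (hG : G.LoopMaximal) {u v w : V}
    (hu : ¬ G.Adj u u) (huv : G.Adj u v) (huw : G.Adj u w) (hvw : v ≠ w) : G.Adj v w := by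
  by_contra hn
  have hvu : v ≠ u := by rintro rfl; exact hu huv
  have hwu : w ≠ u := by rintro rfl; exact hu huw
  have hloops : selfLoops (G.swap u v u w) = insert u (selfLoops G) := by
    ext a
    simp only [selfLoops, Set.mem_ofPred_eq, Set.mem_insert_iff, swap_adj, Sym2.eq_iff, ne_eq]
    grind
  have hle := hG _ (Relation.ReflTransGen.single (doubleEdgeSwap_swap huv huw
    (by simp only [ne_eq, Sym2.eq_iff]; grind) hu hn (by simp only [ne_eq, Sym2.eq_iff]; grind)))
  rw [hloops, Set.ncard_insert_of_notMem (show u ∉ selfLoops G from hu) (Set.toFinite _)] at hle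
  omega

/-- Let `ab` be an edge between loop-free vertices of a loop-maximal graph. A vertex `y` with
a neighbor neither in `{a, b}` nor adjacent to `a` is adjacent to every neighbor of `a` other
than `b`. -/
theorem LoopMaximal.adj_of_not_adj [Finite V] {G : LoopyGraph V} (hG : G.LoopMaximal)
    {a b w y y' : V} (ha : ¬ G.Adj a a) (hb : ¬ G.Adj b b) (hab : G.Adj a b) (haw : G.Adj a w)
    (hwb : w ≠ b) (hyy' : G.Adj y y') (hne : y ≠ y') (hy'a : y' ≠ a) (hy'b : y' ≠ b)
    (hay' : ¬ G.Adj a y') (hyw : y ≠ w) : G.Adj y w := by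
  by_contra hn
  have hwa : w ≠ a := by rintro rfl; exact ha haw
  have hba : b ≠ a := by rintro rfl; exact ha hab
  have hby' : ¬ G.Adj b y' := fun h => hay' (hG.adj_of_adj hb (G.symm _ _ hab) h hy'a.symm)
  have hya : y ≠ a := by rintro rfl; exact hay' hyy'
  have hG' : (G.swap y y' w a).LoopMaximal := hG.swap hyy' (G.symm _ _ haw)
    (by simp only [ne_eq, Sym2.eq_iff]; grind) hn (fun h => hay' (G.symm _ _ h))
    (by simp only [ne_eq, Sym2.eq_iff]; grind) hne hwa hyw hy'a
  have hadj : (G.swap y y' w a).Adj b y' := by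
    refine hG'.adj_of_adj (u := a) ?_ ?_ ?_ hy'b.symm <;>
      simp only [swap_adj, Sym2.eq_iff, ne_eq] <;> grind
  simp only [swap_adj, Sym2.eq_iff, ne_eq] at hadj
  grind

/-- Let `ab` be an edge between loop-free vertices of a loop-maximal graph. All but at most one
of the neighbors of any other loop-free vertex `z` are adjacent to `a`. -/
theorem LoopMaximal.adj_of_adj_of_not_adj [Finite V] {G : LoopyGraph V} (hG : G.LoopMaximal)
    {a b w x z : V} (ha : ¬ G.Adj a a) (hb : ¬ G.Adj b b) (hz : ¬ G.Adj z z) (hab : G.Adj a b)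
    (haz : ¬ G.Adj a z) (hza : z ≠ a) (hzb : z ≠ b) (hzx : G.Adj z x) (hax : ¬ G.Adj a x)
    (hzw : G.Adj z w) (hwx : w ≠ x) : G.Adj a w := by
  have hba : b ≠ a := by rintro rfl; exact ha hab
  have hxz : x ≠ z := by rintro rfl; exact hz hzx
  have hwz : w ≠ z := by rintro rfl; exact hz hzw
  have hxa : x ≠ a := by rintro rfl; exact haz (G.symm _ _ hzx)
  have hwa : w ≠ a := by rintro rfl; exact haz (G.symm _ _ hzw)
  have hbz : ¬ G.Adj b z := fun h => haz (hG.adj_of_adj hb (G.symm _ _ hab) h hza.symm)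
  have hwb : w ≠ b := by rintro rfl; exact hbz (G.symm _ _ hzw)
  have hG' : (G.swap a b x z).LoopMaximal := hG.swap hab (G.symm _ _ hzx)
    (by simp only [ne_eq, Sym2.eq_iff]; grind) hax hbz
    (by simp only [ne_eq, Sym2.eq_iff]; grind) hba.symm hxz hxa.symm hzb.symm
  have hadj : (G.swap a b x z).Adj b w := by
    refine hG'.adj_of_adj (u := z) ?_ ?_ ?_ hwb.symm <;>
      simp only [swap_adj, Sym2.eq_iff, ne_eq] <;> grind
  have hbw : G.Adj b w := by
    simp only [swap_adj, Sym2.eq_iff, ne_eq] at hadj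
    grind
  exact hG.adj_of_adj hb (G.symm _ _ hab) hbw hwa.symm

/-- Removing the self-loops from `G`. -/
def stripLoops (G : LoopyGraph V) : LoopyGraph V where
  Adj a b := a ≠ b ∧ G.Adj a b
  symm _ _ h := ⟨h.1.symm, G.symm _ _ h.2⟩

theorem stripLoops_isSimple (G : LoopyGraph V) : G.stripLoops.IsSimple := fun _ h => h.1 rfl

theorem stripLoops_nbr (G : LoopyGraph V) (u : V) : G.stripLoops.nbr u = G.nbr u := by
  ext v
  simp only [nbr, stripLoops, Set.mem_ofPred_eq]
  grind

theorem IsSimple.deg_eq {G : LoopyGraph V} (hG : G.IsSimple) (u : V) :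
    G.deg u = (G.nbr u).ncard := by
  simp [deg, hG u]

/-- If the loop vertices have the highest degrees, the degree sequence is simple-graphical
after subtracting `2` at each of them. -/
theorem mSimpleGraphical_ncard_selfLoops {G : LoopyGraph V} (h : TopSet G.deg (selfLoops G)) :
    MSimpleGraphical G.deg (selfLoops G).ncard := by
  refine ⟨selfLoops G, rfl, h, fun v hv => ?_, G.stripLoops, G.stripLoops_isSimple, fun v => ?_⟩
  · simp [deg, show G.Adj v v from hv]
  · rw [G.stripLoops_isSimple.deg_eq, stripLoops_nbr]
    by_cases hv : G.Adj v v <;> simp [selfLoops, deg, hv]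

variable [Fintype V]

/-- Double counting of the pairs of adjacent vertices with one vertex in `A`. -/
theorem sum_ncard_nbr (G : LoopyGraph V) (A : Finset V) :
    ∑ v ∈ A, (G.nbr v).ncard = ∑ w, (G.nbr w ∩ A).ncard := by
  have h1 (v : V) : (G.nbr v).ncard = ∑ w, if w ≠ v ∧ G.Adj v w then 1 else 0 := by
    rw [Finset.sum_boole, Nat.cast_id, ← Set.ncard_coe_finset]
    congr 1; ext w; simp [nbr]
  have h2 (w : V) : (G.nbr w ∩ A).ncard = ∑ v ∈ A, if w ≠ v ∧ G.Adj v w then 1 else 0 := by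
    rw [Finset.sum_boole, Nat.cast_id, ← Set.ncard_coe_finset]
    congr 1; ext v
    simp only [nbr, Set.mem_inter_iff, Set.mem_ofPred_eq, Finset.mem_coe, Finset.mem_filter,
      G.adj_comm w v]
    grind
  simp only [h1, h2]
  exact Finset.sum_comm

theorem ncard_nbr_inter_le_of_mem (G : LoopyGraph V) {A : Finset V} {w : V} (hw : w ∈ A) :
    (G.nbr w ∩ A).ncard ≤ A.card - 1 := by
  rw [← Finset.card_erase_of_mem hw, ← Set.ncard_coe_finset]
  refine Set.ncard_le_ncard (fun v hv => ?_) (Set.toFinite _)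
  simpa using ⟨hv.2, hv.1.1⟩

/-- The necessity of the Erdős–Gallai inequalities. -/
theorem sum_ncard_nbr_le (G : LoopyGraph V) (A : Finset V) :
    ∑ v ∈ A, (G.nbr v).ncard ≤
      ∑ _v ∈ A, (A.card - 1) + ∑ v ∈ Aᶜ, min (G.nbr v).ncard A.card := by
  rw [sum_ncard_nbr, ← Finset.sum_add_sum_compl A]
  refine add_le_add (Finset.sum_le_sum fun w hw => G.ncard_nbr_inter_le_of_mem hw)
    (Finset.sum_le_sum fun w _ => le_min ?_ ?_)
  · exact Set.ncard_le_ncard Set.inter_subset_left (Set.toFinite _)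
  · rw [← Set.ncard_coe_finset]
    exact Set.ncard_le_ncard Set.inter_subset_right (Set.toFinite _)

/-- An equality case of the Erdős–Gallai inequalities. -/
theorem sum_ncard_nbr_eq {G : LoopyGraph V} {A : Finset V} (hA : G.IsClique A)
    (h : ∀ v ∉ A, G.nbr v ⊆ A ∨ (A : Set V) ⊆ G.nbr v) :
    ∑ v ∈ A, (G.nbr v).ncard =
      ∑ _v ∈ A, (A.card - 1) + ∑ v ∈ Aᶜ, min (G.nbr v).ncard A.card := by
  refine le_antisymm (G.sum_ncard_nbr_le A) ?_
  rw [sum_ncard_nbr, ← Finset.sum_add_sum_compl A]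
  refine add_le_add (Finset.sum_le_sum fun w hw => ?_) (Finset.sum_le_sum fun w hw => ?_)
  · rw [← Finset.card_erase_of_mem hw, ← Set.ncard_coe_finset]
    refine Set.ncard_le_ncard (fun v hv => ?_) (Set.toFinite _)
    have hv' : v ∈ A ∧ v ≠ w := by simpa using hv
    exact ⟨⟨hv'.2, hA w hw v hv'.1 hv'.2.symm⟩, hv'.1⟩
  · rcases h w (by simpa using hw) with h | h
    · rw [Set.inter_eq_left.2 h]
      exact min_le_left _ _
    · rw [Set.inter_eq_right.2 h, Set.ncard_coe_finset]
      exact min_le_right _ _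

/-- If subtracting `2` from the top sets `L` and `S` of a degree sequence `k` gives a sequence
attaining, respectively satisfying, the Erdős–Gallai bound for a set `A ⊆ L`, and the entries
outside `L` are at most `|A| + 1`, then `S` is no larger than `L`. -/
theorem card_le_card_of_sum_le {k : V → ℕ} {A L S : Finset V} {c : ℕ}
    (hL : TopSet k L) (hS : TopSet k S) (hkS : ∀ v ∈ S, 2 ≤ k v)
    (hAL : A ⊆ L) (hk : ∀ v ∉ L, k v ≤ A.card + 1)
    (hEqL : ∑ v ∈ A, (if v ∈ L then k v - 2 else k v) =
      c + ∑ v ∈ Aᶜ, min (if v ∈ L then k v - 2 else k v) A.card)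
    (hLeS : ∑ v ∈ A, (if v ∈ S then k v - 2 else k v) ≤
      c + ∑ v ∈ Aᶜ, min (if v ∈ S then k v - 2 else k v) A.card) :
    S.card ≤ L.card := by
  by_contra! hlt
  let h : V → ℕ := fun v => min (k v) A.card - min (k v - 2) A.card
  have key : ∑ v ∈ S \ L, h v ≤ ∑ v ∈ L \ S, h v := by
    have e1 : ∑ v ∈ S \ L, h v = ∑ v ∈ Aᶜ, if v ∈ S \ L then h v else 0 := by
      rw [← Finset.sum_filter]
      congr 1
      ext v
      have := @hAL v
      simp only [Finset.mem_sdiff, Finset.mem_filter, Finset.mem_compl]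
      tauto
    have e2 : ∑ v ∈ Aᶜ, (if v ∈ L \ S then h v else 0) ≤ ∑ v ∈ L \ S, h v := by
      rw [← Finset.sum_filter]
      refine Finset.sum_le_sum_of_subset fun v hv => ?_
      exact (Finset.mem_filter.1 hv).2
    have e3 : ∑ v ∈ A, (if v ∈ L then k v - 2 else k v) ≤
        ∑ v ∈ A, (if v ∈ S then k v - 2 else k v) := by
      refine Finset.sum_le_sum fun v hv => ?_
      rw [if_pos (hAL hv)]
      split_ifs <;> omega
    have e4 : ∑ v ∈ Aᶜ, min (if v ∈ S then k v - 2 else k v) A.card +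
          ∑ v ∈ Aᶜ, (if v ∈ S \ L then h v else 0) =
        ∑ v ∈ Aᶜ, min (if v ∈ L then k v - 2 else k v) A.card +
          ∑ v ∈ Aᶜ, (if v ∈ L \ S then h v else 0) := by
      rw [← Finset.sum_add_distrib, ← Finset.sum_add_distrib]
      refine Finset.sum_congr rfl fun v _ => ?_
      simp only [Finset.mem_sdiff, h]
      by_cases h1 : v ∈ S <;> by_cases h2 : v ∈ L <;> simp [h1, h2]
    omega
  have hpos : ∀ v ∈ S \ L, 0 < h v := by
    intro v hv
    obtain ⟨hvS, hvL⟩ := Finset.mem_sdiff.1 hv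
    have := hkS v hvS
    have := hk v hvL
    simp only [h]
    omega
  have hcard : (L \ S).card < (S \ L).card := by
    have h1 := Finset.card_sdiff_add_card_inter S L
    have h2 := Finset.card_sdiff_add_card_inter L S
    rw [Finset.inter_comm L S] at h2
    omega
  obtain ⟨v₀, hv₀⟩ := Finset.card_pos.1 (Nat.zero_lt_of_lt hcard)
  have hle : ∀ u ∈ L \ S, ∀ v ∈ S \ L, k u = k v := by
    intro u hu v hv
    obtain ⟨hu1, hu2⟩ := Finset.mem_sdiff.1 hu
    obtain ⟨hv1, hv2⟩ := Finset.mem_sdiff.1 hv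
    exact le_antisymm (hS v hv1 u hu2) (hL u hu1 v hv2)
  rcases (L \ S).eq_empty_or_nonempty with he | ⟨u₀, hu₀⟩
  · rw [he, Finset.sum_empty] at key
    have := Finset.sum_pos hpos ⟨v₀, hv₀⟩
    omega
  · rw [Finset.sum_congr rfl fun v hv => show h v = h u₀ by simp only [h, hle u₀ hu₀ v hv],
      Finset.sum_congr (s₁ := L \ S) rfl fun u hu => show h u = h u₀ by
        simp only [h, hle u hu v₀ hv₀, hle u₀ hu₀ v₀ hv₀],
      Finset.sum_const, Finset.sum_const, smul_eq_mul, smul_eq_mul] at key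
    have h0 : 0 < h u₀ := by
      have := hpos v₀ hv₀
      simpa only [h, hle u₀ hu₀ v₀ hv₀] using this
    exact absurd (Nat.le_of_mul_le_mul_right key h0) (not_le.2 hcard)

end LoopyGraph

/-- A swap-maximal loopy graph `Ĝ^2` (largest clique in `V^0` has exactly
two vertices) in which every vertex of `V^0` has degree at most that of every vertex not
in `V^0` is `m*`-loopy. -/
theorem Ghat2_is_mStar_loopy {V : Type} [Fintype V] (G : LoopyGraph V) (k : V → ℕ)
    (hdeg : ∀ v, G.deg v = k v) (hmax : G.SwapMaximal)
    (K : Set V) (hK : LoopyGraph.LargestV0Clique G K 2)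
    (hdc : ∀ u ∈ LoopyGraph.Vset G 0, ∀ x : V, x ∉ LoopyGraph.Vset G 0 →
      G.deg u ≤ G.deg x)
    (m : ℕ) (hm : LoopyGraph.IsMStar k m) :
    G.MLoopy m := by
  open LoopyGraph in
  obtain rfl : G.deg = k := funext hdeg
  have hG : G.LoopMaximal := fun H hH => (hmax H hH).1
  have hL : TopSet G.deg (selfLoops G) := fun u hu v hv => hdc v hv u fun h => h hu
  refine ⟨le_antisymm (hm.2 _ (mSimpleGraphical_ncard_selfLoops hL)) ?_, hL⟩
  obtain ⟨hK0, hKc, hKcard, hKmax⟩ := hK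
  obtain ⟨a, b, hne, rfl⟩ := Set.ncard_eq_two.1 hKcard
  have ha : ¬ G.Adj a a := hK0 (by simp)
  have hb : ¬ G.Adj b b := hK0 (by simp)
  have hab : G.Adj a b := hKc a (by simp) b (by simp) hne
  have hba : G.Adj b a := G.symm _ _ hab
  let A : Finset V := Finset.univ.filter fun w => w ≠ b ∧ G.Adj a w
  have hA (w : V) : w ∈ A ↔ w ≠ b ∧ G.Adj a w := by simp [A]
  have hbA : ∀ w ∈ A, G.Adj b w := fun w hw =>
    hG.adj_of_adj ha hab ((hA w).1 hw).2 ((hA w).1 hw).1.symm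
  have hAclique : G.IsClique A := fun x hx y hy hxy =>
    hG.adj_of_adj ha ((hA x).1 hx).2 ((hA y).1 hy).2 hxy
  have hAL : ∀ w ∈ A, G.Adj w w := by
    intro w hw
    by_contra hn
    obtain ⟨hwb, haw⟩ := (hA w).1 hw
    have hwa : w ≠ a := by rintro rfl; exact ha haw
    have h3 := hKmax {w, a, b} (by
      rintro v (rfl | rfl | rfl)
      exacts [hn, ha, hb]) (by
      have := hbA w hw
      have := G.symm a w haw
      have := G.symm b w (hbA w hw)
      rintro x (rfl | rfl | rfl) y (rfl | rfl | rfl) hxy <;>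
        first | exact absurd rfl hxy | assumption)
    rw [Set.ncard_insert_of_notMem (by simp [hwa, hwb]) (Set.toFinite _), hKcard] at h3
    omega
  have hsplit : ∀ v ∉ A, G.nbr v ⊆ A ∨ (A : Set V) ⊆ G.nbr v := by
    intro y hy
    by_contra! hcon
    obtain ⟨y', hyy', hy'A⟩ := Set.not_subset.1 hcon.1
    obtain ⟨w, hwA, hyw⟩ := Set.not_subset.1 hcon.2
    obtain ⟨hwb, haw⟩ := (hA w).1 hwA
    have hwy : w ≠ y := by rintro rfl; exact hy hwA
    have hya : y ≠ a := by rintro rfl; exact hyw ⟨hwy, haw⟩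
    have hyb : y ≠ b := by rintro rfl; exact hyw ⟨hwy, hbA w hwA⟩
    have hy'a : y' ≠ a := by
      rintro rfl
      exact hy ((hA y).2 ⟨hyb, G.symm _ _ hyy'.2⟩)
    have hy'b : y' ≠ b := by
      rintro rfl
      exact hy ((hA y).2 ⟨hyb, hG.adj_of_adj hb hba (G.symm _ _ hyy'.2) hya.symm⟩)
    exact hyw ⟨hwy, hG.adj_of_not_adj ha hb hab haw hwb hyy'.2 hyy'.1.symm hy'a hy'b
      (fun h => hy'A ((hA y').2 ⟨hy'b, h⟩)) hwy.symm⟩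
  have hinsert : ∀ z x : V, ¬ G.Adj z z → G.nbr z ⊆ insert x (A : Set V) →
      G.deg z ≤ A.card + 1 := by
    intro z x hz hsub
    simp only [deg, if_neg hz, add_zero]
    calc (G.nbr z).ncard ≤ (insert x (A : Set V)).ncard :=
          Set.ncard_le_ncard hsub (Set.toFinite _)
      _ ≤ (A : Set V).ncard + 1 := Set.ncard_insert_le _ _
      _ = A.card + 1 := by rw [Set.ncard_coe_finset]
  have hsmall : ∀ z, ¬ G.Adj z z → G.deg z ≤ A.card + 1 := by
    intro z hz
    by_cases hza : z = a
    · subst hza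
      refine hinsert z b hz fun w hw => ?_
      by_cases hwb : w = b
      · exact Or.inl hwb
      · exact Or.inr ((hA w).2 ⟨hwb, hw.2⟩)
    by_cases hzb : z = b
    · subst hzb
      refine hinsert z a hz fun w hw => ?_
      by_cases hwa : w = a
      · exact Or.inl hwa
      · exact Or.inr ((hA w).2 ⟨hw.1, hG.adj_of_adj hb hba hw.2 (Ne.symm hwa)⟩)
    by_cases hsub : G.nbr z ⊆ A
    · exact hinsert z a hz (hsub.trans (Set.subset_insert _ _))
    obtain ⟨x, hzx, hxA⟩ := Set.not_subset.1 hsub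
    have haz : ¬ G.Adj a z := fun h => hz (hAL z ((hA z).2 ⟨hzb, h⟩))
    have hbz : ¬ G.Adj b z := fun h => haz (hG.adj_of_adj hb hba h (Ne.symm hza))
    have hxb : ∀ w, G.Adj z w → w ≠ b := by
      rintro w hw rfl
      exact hbz (G.symm _ _ hw)
    refine hinsert z x hz fun w hw => ?_
    by_cases hwx : w = x
    · exact Or.inl hwx
    · exact Or.inr ((hA w).2 ⟨hxb w hw.2, hG.adj_of_adj_of_not_adj ha hb hz hab haz hza hzb
        hzx.2 (fun h => hxA ((hA x).2 ⟨hxb x hzx.2, h⟩)) hw.2 hwx⟩)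
  obtain ⟨S, rfl, hStop, hS2, H, hHsimple, hHdeg⟩ := hm.1
  have hEq := sum_ncard_nbr_eq hAclique hsplit
  have hLe := H.sum_ncard_nbr_le A
  have hHn (v : V) : (H.nbr v).ncard = if v ∈ S.toFinset then G.deg v - 2 else G.deg v := by
    rw [← hHsimple.deg_eq, hHdeg]
    simp
  have hloop (v : V) : v ∈ (selfLoops G).toFinset ↔ G.Adj v v := Set.mem_toFinset
  have hGn (v : V) :
      (G.nbr v).ncard = if v ∈ (selfLoops G).toFinset then G.deg v - 2 else G.deg v := by
    by_cases hv : G.Adj v v <;> simp only [hloop, hv, deg] <;> simp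
  simp only [hHn] at hLe
  simp only [hGn] at hEq
  rw [Set.ncard_eq_toFinset_card', Set.ncard_eq_toFinset_card']
  exact card_le_card_of_sum_le (k := G.deg) (by simpa using hL) (by simpa using hStop)
    (by simpa using hS2) (fun w hw => (hloop w).2 (hAL w hw))
    (fun v hv => hsmall v (mt (hloop v).2 hv)) hEq hLe
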